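/- arXiv:2501.04728 — 5 statements merged into one kernel-verified Lean document; each statement's English description precedes it below -/
import Mathlib

section
/- Let X = ℓ∞(ℝ) with the supremum norm, let C ⊆ X be the cone of nonnegative functions, and let A ⊆ X be the set of functions f for which there exists a countably infinite set X_f ⊆ ℝ with f(x) = -1 on X_f and f(x) = 0 off X_f. Then for every finite subset {f₁, …, f_k} ⊆ A there exists f ∈ A such that f ∉ ⋃_{i=1}^{k} (U(f_i,1) + C), where U(f_i,1) is the open ball of radius 1 centered at f_i. In particular, no finite subfamily of the cover {U(f,1) + C : f ∈ A} covers A. -/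
open Pointwise Filter Topology

/-- `ℓ∞(ℝ)`: the Banach space of bounded functions from `ℝ` to `ℝ` with the sup norm. -/
noncomputable abbrev Linf : Type := lp (fun _ : ℝ => ℝ) ⊤

/-- The set `A` of functions equal to `-1` on a countably infinite set and `0` elsewhere. -/
def setA : Set Linf :=
  {f | ∃ S : Set ℝ, S.Countable ∧ S.Infinite ∧ (∀ x ∈ S, f x = -1) ∧ (∀ x ∉ S, f x = 0)}

/-- The cone `C` of nonnegative functions in `ℓ∞(ℝ)`. -/
def coneC : Set Linf := {h | ∀ x : ℝ, 0 ≤ h x}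

theorem countable_support_of_mem_setA {f : Linf} (hf : f ∈ setA) :
    {x : ℝ | f x ≠ 0}.Countable := by
  obtain ⟨S, hS, -, -, h0⟩ := hf
  exact hS.mono fun x hx => by_contra fun hxS => hx (h0 x hxS)

/-- A countably infinite subset of `ℝ` yields an element of `setA` equal to `-1` on it. -/
theorem exists_mem_setA_eq_neg_one {T : Set ℝ} (hT : T.Countable) (hTi : T.Infinite) :
    ∃ f ∈ setA, ∀ x ∈ T, f x = -1 := by
  have hmem : Memℓp (T.indicator fun _ => (-1 : ℝ)) ⊤ := by
    refine memℓp_infty ⟨1, ?_⟩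
    rintro _ ⟨x, rfl⟩
    by_cases hx : x ∈ T <;> simp [hx]
  let f : Linf := ⟨T.indicator fun _ => (-1 : ℝ), hmem⟩
  have hf : ∀ x ∈ T, f x = -1 := fun x hx => Set.indicator_of_mem hx fun _ => (-1 : ℝ)
  exact ⟨f, ⟨T, hT, hTi, hf, fun x hx => Set.indicator_of_notMem hx fun _ => (-1 : ℝ)⟩, hf⟩

theorem sub_one_lt_apply_of_mem_ball_add_coneC {f g : Linf}
    (hf : f ∈ Metric.ball g 1 + coneC) (x : ℝ) : g x - 1 < f x := by
  obtain ⟨u, hu, h, hh, rfl⟩ := Set.mem_add.1 hf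
  have hlt : ‖(u - g) x‖ < 1 :=
    (lp.norm_apply_le_norm ENNReal.top_ne_zero (u - g) x).trans_lt (mem_ball_iff_norm.1 hu)
  have hsub : (u - g) x = u x - g x := rfl
  have hadd : (u + h) x = u x + h x := rfl
  rw [hsub, Real.norm_eq_abs, abs_lt] at hlt
  rw [hadd]
  linarith [hh x, hlt.1]

theorem no_finite_subcover (s : Finset Linf) (hs : ↑s ⊆ setA) :
    (∃ f ∈ setA, f ∉ ⋃ g ∈ s, Metric.ball g 1 + coneC) ∧
      ¬ setA ⊆ ⋃ g ∈ s, Metric.ball g 1 + coneC := by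
  have key : ∃ f ∈ setA, f ∉ ⋃ g ∈ s, Metric.ball g 1 + coneC := by
    have hcount : (⋃ g ∈ s, {x : ℝ | g x ≠ 0}).Countable :=
      s.countable_toSet.biUnion fun g hg => countable_support_of_mem_setA (hs hg)
    have hinf : (⋃ g ∈ s, {x : ℝ | g x ≠ 0})ᶜ.Infinite := fun hfin =>
      Set.not_countable_univ (α := ℝ) <| by
        simpa only [Set.union_compl_self] using hcount.union hfin.countable
    obtain ⟨T, hTsub, hT, hTi⟩ := hinf.exists_subset_countable_infinite
    obtain ⟨f, hfA, hf⟩ := exists_mem_setA_eq_neg_one hT hTi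
    refine ⟨f, hfA, fun hmem => ?_⟩
    obtain ⟨g, hg, hfg⟩ := Set.mem_iUnion₂.1 hmem
    obtain ⟨x, hx⟩ := hTi.nonempty
    have hgx : g x = 0 := by_contra fun h => hTsub hx (Set.mem_biUnion hg h)
    have := sub_one_lt_apply_of_mem_ball_add_coneC hfg x
    rw [hgx, hf x hx] at this
    norm_num at this
  obtain ⟨f, hfA, hf⟩ := key
  exact ⟨⟨f, hfA, hf⟩, fun h => hf (h hfA)⟩
end

section
/- Let X = ℓ∞(ℝ) with the supremum norm, let C ⊆ X be the cone of nonnegative functions, and let A ⊆ X be the set of functions f for which there exists a countably infinite set X_f ⊆ ℝ with f(x) = -1 on X_f and f(x) = 0 off X_f. Then for every sequence (f_n)_{n ≥ 1} ⊆ A there exists a single function g ∈ A such that f_n − g ∈ C for every n ≥ 1; that is, setting g_n := f_n − g, the sequence (g_n) lies in C and f_n − g_n = g ∈ A for all n (the sequence (f_n − g_n) is stationary at an element of A). -/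
open Pointwise Filter Topology

theorem exists_common_minorant (f : ℕ → Linf) (hf : ∀ n, f n ∈ setA) :
    ∃ g ∈ setA, ∀ n, f n - g ∈ coneC := by
  choose S hc hi h1 h0 using hf
  have hmem : Memℓp ((⋃ n, S n).indicator fun _ : ℝ => (-1 : ℝ)) ⊤ := by
    refine memℓp_infty ⟨1, ?_⟩
    rintro _ ⟨x, rfl⟩
    by_cases hx : x ∈ ⋃ n, S n <;> simp [Set.indicator, hx]
  refine ⟨⟨_, hmem⟩, ⟨⋃ n, S n, Set.countable_iUnion hc,
    (hi 0).mono (Set.subset_iUnion S 0), fun x hx => Set.indicator_of_mem hx fun _ => (-1 : ℝ),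
    fun x hx => Set.indicator_of_notMem hx fun _ => (-1 : ℝ)⟩, fun n x => ?_⟩
  change 0 ≤ f n x - (⋃ n, S n).indicator (fun _ : ℝ => (-1 : ℝ)) x
  by_cases hx : x ∈ S n
  · rw [h1 n x hx, Set.indicator_of_mem (Set.mem_iUnion_of_mem n hx), sub_self]
  · rw [h0 n x hx, sub_nonneg]
    exact Set.indicator_nonpos (fun _ _ => by norm_num) x
end

section
/- Let X = ℓ∞(ℝ) with the supremum norm, let C ⊆ X be the cone of nonnegative functions, and let A ⊆ X be the set of functions f for which there exists a countably infinite set X_f ⊆ ℝ with f(x) = -1 on X_f and f(x) = 0 off X_f. Then A is C-sequentially compact: for every sequence (f_n)_{n ≥ 1} ⊆ A there exists a sequence (c_n)_{n ≥ 1} ⊆ C such that the sequence (f_n − c_n)_{n ≥ 1} has a subsequence converging (in the supremum norm) to an element of A. -/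
open Pointwise Filter Topology

theorem setA_cone_seq_compact (a : ℕ → Linf) (ha : ∀ n, a n ∈ setA) :
    ∃ c : ℕ → Linf, (∀ n, c n ∈ coneC) ∧
      ∃ φ : ℕ → ℕ, StrictMono φ ∧
        ∃ l ∈ setA, Tendsto (fun n => a (φ n) - c (φ n)) atTop (𝓝 l) := by
  classical
  choose S hc hi h1 h0 using ha
  -- The constant sequence at `-1` times the indicator of `⋃ n, S n` works.
  have hmem : Memℓp (fun x : ℝ => if x ∈ ⋃ n, S n then (-1 : ℝ) else 0) ⊤ := by
    refine memℓp_infty ⟨1, ?_⟩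
    rintro _ ⟨x, rfl⟩
    dsimp only
    split_ifs <;> simp
  let l : Linf := ⟨_, hmem⟩
  have hl : ∀ x, l x = if x ∈ ⋃ n, S n then (-1 : ℝ) else 0 := fun _ => rfl
  refine ⟨fun n => a n - l, fun n x => ?_, id, strictMono_id, l, ?_, ?_⟩
  · rw [lp.coeFn_sub, Pi.sub_apply, hl, sub_nonneg]
    by_cases hx : x ∈ S n
    · rw [if_pos (Set.mem_iUnion_of_mem n hx), h1 n x hx]
    · rw [h0 n x hx]
      split_ifs <;> norm_num
  · exact ⟨⋃ n, S n, Set.countable_iUnion hc, (hi 0).mono (Set.subset_iUnion S 0),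
      fun x hx => by rw [hl, if_pos hx], fun x hx => by rw [hl, if_neg hx]⟩
  · simp
end

section
/- Let X = ℓ∞(ℝ) with the supremum norm, let C ⊆ X be the cone of nonnegative functions, and let A ⊆ X be the set of functions f for which there exists a countably infinite set X_f ⊆ ℝ with f(x) = -1 on X_f and f(x) = 0 off X_f. Then A is C-sequentially compact but not C-compact; consequently, in the absence of separability, sequential cone compactness does not imply cone compactness. -/
open Pointwise Filter Topology

/-- A set `A` is `C`-compact if every cover of `A` by sets of the form `U + C`,
with `U` open, admits a finite subcover. -/
def ConeCompact {X : Type*} [NormedAddCommGroup X] [NormedSpace ℝ X]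
    (C A : Set X) : Prop :=
  ∀ (I : Type) (U : I → Set X), (∀ i, IsOpen (U i)) → A ⊆ ⋃ i, U i + C →
    ∃ J : Finset I, A ⊆ ⋃ i ∈ J, U i + C

/-- A set `A` is `C`-sequentially compact if for every sequence in `A` there is a
sequence in `C` such that the difference sequence has a subsequence converging to
an element of `A`. -/
def ConeSeqCompact {X : Type*} [NormedAddCommGroup X] [NormedSpace ℝ X]
    (C A : Set X) : Prop :=
  ∀ a : ℕ → X, (∀ n, a n ∈ A) → ∃ c : ℕ → X, (∀ n, c n ∈ C) ∧
    ∃ φ : ℕ → ℕ, StrictMono φ ∧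
      ∃ l ∈ A, Filter.Tendsto (fun n => a (φ n) - c (φ n)) Filter.atTop (nhds l)

/-- The function equal to `-1` on `S` and `0` elsewhere, as an element of `ℓ∞(ℝ)`. -/
noncomputable def negIndicator (S : Set ℝ) : Linf :=
  ⟨S.indicator fun _ => -1, memℓp_infty ⟨1, by
    rintro _ ⟨x, rfl⟩
    by_cases hx : x ∈ S <;> simp [hx]⟩⟩

lemma negIndicator_of_mem {S : Set ℝ} {x : ℝ} (hx : x ∈ S) : negIndicator S x = -1 :=
  Set.indicator_of_mem hx fun _ => (-1 : ℝ)

lemma negIndicator_of_notMem {S : Set ℝ} {x : ℝ} (hx : x ∉ S) : negIndicator S x = 0 :=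
  Set.indicator_of_notMem hx fun _ => (-1 : ℝ)

lemma negIndicator_mem_setA {S : Set ℝ} (hc : S.Countable) (hi : S.Infinite) :
    negIndicator S ∈ setA :=
  ⟨S, hc, hi, fun _ => negIndicator_of_mem, fun _ => negIndicator_of_notMem⟩

lemma coneSeqCompact_setA : ConeSeqCompact coneC setA := by
  intro a ha
  choose S hc hi hneg hzero using ha
  refine ⟨fun n => a n - negIndicator (⋃ n, S n), fun n x => ?_, id, strictMono_id,
    negIndicator (⋃ n, S n), negIndicator_mem_setA (Set.countable_iUnion hc)
      ((hi 0).mono (Set.subset_iUnion S 0)), by simp⟩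
  rw [lp.coeFn_sub, Pi.sub_apply]
  by_cases hx : x ∈ S n
  · simp [hneg n x hx, negIndicator_of_mem (Set.mem_iUnion_of_mem n hx)]
  · rw [hzero n x hx]
    by_cases hxU : x ∈ ⋃ n, S n
    · simp [negIndicator_of_mem hxU]
    · simp [negIndicator_of_notMem hxU]

/-- Elements of `ball f r + coneC` lie pointwise above `f - r`. -/
lemma sub_lt_of_mem_ball_add_coneC {f g : Linf} {r : ℝ} (hg : g ∈ Metric.ball f r + coneC)
    (x : ℝ) : f x - r < g x := by
  obtain ⟨u, hu, c, hc, rfl⟩ := hg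
  have hnorm : ‖(u - f) x‖ ≤ ‖u - f‖ := lp.norm_apply_le_norm ENNReal.top_ne_zero _ x
  rw [mem_ball_iff_norm] at hu
  rw [lp.coeFn_sub, Pi.sub_apply, Real.norm_eq_abs] at hnorm
  rw [lp.coeFn_add, Pi.add_apply]
  linarith [(abs_le.mp hnorm).1, hc x]

lemma not_coneCompact_setA : ¬ ConeCompact coneC setA := by
  intro h
  obtain ⟨J, hJ⟩ := h setA (fun f => Metric.ball (f : Linf) (1 / 2))
    (fun _ => Metric.isOpen_ball) fun f hf =>
      Set.mem_iUnion_of_mem ⟨f, hf⟩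
        ⟨f, Metric.mem_ball_self (by norm_num), 0, fun _ => le_rfl, add_zero f⟩
  have hA : ∀ f : setA, ∃ S : Set ℝ, S.Countable ∧ ∀ x ∉ S, (f : Linf) x = 0 :=
    fun ⟨_, S, hc, _, _, hzero⟩ => ⟨S, hc, hzero⟩
  choose S hc hzero using hA
  have hunion : (⋃ f ∈ J, S f).Countable := J.countable_toSet.biUnion fun f _ => hc f
  obtain ⟨y, hy⟩ : ∃ y, y ∉ ⋃ f ∈ J, S f := by
    by_contra! hall
    exact Set.not_countable_univ (α := ℝ) (Set.eq_univ_of_forall hall ▸ hunion)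
  have hmem : negIndicator (insert y (Set.range ((↑) : ℕ → ℝ))) ∈ setA :=
    negIndicator_mem_setA ((Set.countable_range _).insert y)
      ((Set.infinite_range_of_injective Nat.cast_injective).mono (Set.subset_insert _ _))
  obtain ⟨f, hf, hmem_f⟩ := Set.mem_iUnion₂.mp (hJ hmem)
  have hlt := sub_lt_of_mem_ball_add_coneC hmem_f y
  rw [hzero f y fun hyf => hy (Set.mem_biUnion hf hyf),
    negIndicator_of_mem (Set.mem_insert y _)] at hlt
  norm_num at hlt

theorem setA_seq_cone_compact_not_cone_compact :
    ConeSeqCompact coneC setA ∧ ¬ ConeCompact coneC setA :=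
  ⟨coneSeqCompact_setA, not_coneCompact_setA⟩
end

section
/- Let X be a normed vector space, C ⊆ X a closed convex cone, and A ⊆ X a nonempty set. If A is C-sequentially compact and A is separable (as a metric subspace of X), then A is C-compact. -/
open Pointwise

theorem TopologicalSpace.IsSeparable.isLindelof {X : Type*} [PseudoMetricSpace X] {s : Set X}
    (hs : TopologicalSpace.IsSeparable s) : IsLindelof s := by
  have := hs.separableSpace
  have := UniformSpace.secondCountable_of_separable s
  exact isLindelof_iff_lindelofSpace.2 inferInstance

theorem Convex.add_mem_of_smul_mem {X : Type*} [AddCommGroup X] [Module ℝ X] {C : Set X}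
    (hC : Convex ℝ C) (hcone : ∀ c ∈ C, ∀ t : ℝ, 0 ≤ t → t • c ∈ C) {x y : X}
    (hx : x ∈ C) (hy : y ∈ C) : x + y ∈ C := by
  have hmid : (1 / 2 : ℝ) • x + (1 / 2 : ℝ) • y ∈ C :=
    hC hx hy (by norm_num) (by norm_num) (by norm_num)
  simpa [smul_smul] using hcone _ hmid 2 zero_le_two

theorem coneSeqCompact_separable_imp_coneCompact {X : Type*} [NormedAddCommGroup X]
    [NormedSpace ℝ X] (C A : Set X) (hCclosed : IsClosed C) (hCconvex : Convex ℝ C)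
    (hCcone : ∀ c ∈ C, ∀ t : ℝ, 0 ≤ t → t • c ∈ C) (hA : A.Nonempty)
    (hsep : TopologicalSpace.IsSeparable A)
    (h : ConeSeqCompact C A) : ConeCompact C A := by
  classical
  intro I U hU hcover
  have hopen : ∀ i, IsOpen (U i + C) := fun i => (hU i).add_right
  obtain ⟨r, hr, hAr⟩ := hsep.isLindelof.elim_countable_subcover _ hopen hcover
  have hr_nonempty : r.Nonempty := by
    obtain ⟨x, hx⟩ := hA
    obtain ⟨i, hi, -⟩ := Set.mem_iUnion₂.1 (hAr hx)
    exact ⟨i, hi⟩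
  obtain ⟨f, rfl⟩ := hr.exists_eq_range hr_nonempty
  by_contra! hfin
  choose a haA ha using fun n : ℕ => Set.not_subset.1 (hfin ((Finset.range (n + 1)).image f))
  obtain ⟨c, hc, φ, hφ, l, hl, hlim⟩ := h a haA
  obtain ⟨_, ⟨m, rfl⟩, hlm⟩ := Set.mem_iUnion₂.1 (hAr hl)
  obtain ⟨n, hn, hmn⟩ :=
    ((hlim.eventually ((hopen (f m)).mem_nhds hlm)).and (Filter.eventually_ge_atTop m)).exists
  obtain ⟨u, hu, d, hd, hud⟩ := Set.mem_add.1 hn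
  refine ha (φ n) (Set.mem_iUnion₂.2 ⟨f m, Finset.mem_image_of_mem f ?_, ?_⟩)
  · exact Finset.mem_range.2 (Nat.lt_succ_of_le (hmn.trans (hφ.id_le n)))
  · refine Set.mem_add.2 ⟨u, hu, d + c (φ n),
      hCconvex.add_mem_of_smul_mem hCcone hd (hc (φ n)), ?_⟩
    rw [← add_assoc, hud, sub_add_cancel]
end
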